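/- arXiv:2507.17890 — 3 statements merged into one kernel-verified Lean document; each statement's English description precedes it below -/
import Mathlib

section
/- There exist finite-dimensional complex vector spaces A₁, A₂, B₁, B₂, C₁, C₂ and a tensor T ∈ (A₁⊕A₂)⊗(B₁⊕B₂)⊗(C₁⊕C₂) such that, writing T_{ijk} = T|_{A_i^*⊗B_j^*⊗C_k^*} ∈ A_i⊗B_j⊗C_k for the blocks of T (i,j,k ∈ {1,2}), one has R(T) < min R(T₁₁₁ mod (T₂₁₁(A₂^*), T₁₂₁(B₂^*), T₁₁₂(C₂^*))) + min R(T₂₂₂ mod (T₁₂₂(A₁^*), T₂₁₂(B₁^*), T₂₂₁(C₁^*))). -/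
open TensorProduct

/-- The rank of a 3-tensor `T ∈ A ⊗ B ⊗ C`. -/
noncomputable def tRank3 {A B C : Type*} [AddCommGroup A] [Module ℂ A]
    [AddCommGroup B] [Module ℂ B] [AddCommGroup C] [Module ℂ C]
    (T : A ⊗[ℂ] (B ⊗[ℂ] C)) : ℕ :=
  sInf {r : ℕ | ∃ (a : Fin r → A) (b : Fin r → B) (c : Fin r → C),
    T = ∑ i, a i ⊗ₜ[ℂ] (b i ⊗ₜ[ℂ] c i)}

section Defs

variable {A B C : Type*} [AddCommGroup A] [Module ℂ A]
  [AddCommGroup B] [Module ℂ B] [AddCommGroup C] [Module ℂ C]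

/-- The image `T(A^*) ⊆ B ⊗ C` of the flattening `T_A : A^* → B ⊗ C`. -/
noncomputable def flatImageA (T : A ⊗[ℂ] (B ⊗[ℂ] C)) : Submodule ℂ (B ⊗[ℂ] C) :=
  Submodule.span ℂ {x | ∃ f : Module.Dual ℂ A,
    x = TensorProduct.lid ℂ (B ⊗[ℂ] C) (TensorProduct.map f LinearMap.id T)}

/-- The image `T(B^*) ⊆ A ⊗ C` of the flattening `T_B : B^* → A ⊗ C`. -/
noncomputable def flatImageB (T : A ⊗[ℂ] (B ⊗[ℂ] C)) : Submodule ℂ (A ⊗[ℂ] C) :=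
  Submodule.span ℂ {x | ∃ f : Module.Dual ℂ B,
    x = TensorProduct.map LinearMap.id (TensorProduct.lid ℂ C).toLinearMap
      (TensorProduct.map LinearMap.id (TensorProduct.map f LinearMap.id) T)}

/-- The image `T(C^*) ⊆ A ⊗ B` of the flattening `T_C : C^* → A ⊗ B`. -/
noncomputable def flatImageC (T : A ⊗[ℂ] (B ⊗[ℂ] C)) : Submodule ℂ (A ⊗[ℂ] B) :=
  Submodule.span ℂ {x | ∃ f : Module.Dual ℂ C,
    x = TensorProduct.map LinearMap.id (TensorProduct.rid ℂ B).toLinearMap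
      (TensorProduct.map LinearMap.id (TensorProduct.map LinearMap.id f) T)}

/-- Modifications of `T` by `(W_A, W_B, W_C)`. -/
def modSet (T : A ⊗[ℂ] (B ⊗[ℂ] C)) (WA : Submodule ℂ (B ⊗[ℂ] C))
    (WB : Submodule ℂ (A ⊗[ℂ] C)) (WC : Submodule ℂ (A ⊗[ℂ] B)) :
    Set (A ⊗[ℂ] (B ⊗[ℂ] C)) :=
  {T' | ∃ XA ∈ Submodule.span ℂ {x | ∃ a : A, ∃ w ∈ WA, x = a ⊗ₜ[ℂ] w},
    ∃ XB ∈ Submodule.span ℂ {x | ∃ b : B, ∃ w ∈ WB,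
      x = TensorProduct.map LinearMap.id (TensorProduct.comm ℂ C B).toLinearMap
        ((TensorProduct.assoc ℂ A C B) (w ⊗ₜ[ℂ] b))},
    ∃ XC ∈ Submodule.span ℂ {x | ∃ c : C, ∃ w ∈ WC,
      x = (TensorProduct.assoc ℂ A B C) (w ⊗ₜ[ℂ] c)},
    T' = T + XA + XB + XC}

/-- `min R(T mod (W_A, W_B, W_C))`. -/
noncomputable def minModRank (T : A ⊗[ℂ] (B ⊗[ℂ] C)) (WA : Submodule ℂ (B ⊗[ℂ] C))
    (WB : Submodule ℂ (A ⊗[ℂ] C)) (WC : Submodule ℂ (A ⊗[ℂ] B)) : ℕ :=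
  sInf (tRank3 '' modSet T WA WB WC)

variable {A₁ A₂ B₁ B₂ C₁ C₂ : Type*}
  [AddCommGroup A₁] [Module ℂ A₁] [AddCommGroup A₂] [Module ℂ A₂]
  [AddCommGroup B₁] [Module ℂ B₁] [AddCommGroup B₂] [Module ℂ B₂]
  [AddCommGroup C₁] [Module ℂ C₁] [AddCommGroup C₂] [Module ℂ C₂]

/-- The block `T_{111}` of `T ∈ (A₁⊕A₂)⊗(B₁⊕B₂)⊗(C₁⊕C₂)`. -/
noncomputable def block111 (T : (A₁ × A₂) ⊗[ℂ] ((B₁ × B₂) ⊗[ℂ] (C₁ × C₂))) :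
    A₁ ⊗[ℂ] (B₁ ⊗[ℂ] C₁) :=
  TensorProduct.map (LinearMap.fst ℂ A₁ A₂)
    (TensorProduct.map (LinearMap.fst ℂ B₁ B₂) (LinearMap.fst ℂ C₁ C₂)) T

/-- The block `T_{211}`. -/
noncomputable def block211 (T : (A₁ × A₂) ⊗[ℂ] ((B₁ × B₂) ⊗[ℂ] (C₁ × C₂))) :
    A₂ ⊗[ℂ] (B₁ ⊗[ℂ] C₁) :=
  TensorProduct.map (LinearMap.snd ℂ A₁ A₂)
    (TensorProduct.map (LinearMap.fst ℂ B₁ B₂) (LinearMap.fst ℂ C₁ C₂)) T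

/-- The block `T_{121}`. -/
noncomputable def block121 (T : (A₁ × A₂) ⊗[ℂ] ((B₁ × B₂) ⊗[ℂ] (C₁ × C₂))) :
    A₁ ⊗[ℂ] (B₂ ⊗[ℂ] C₁) :=
  TensorProduct.map (LinearMap.fst ℂ A₁ A₂)
    (TensorProduct.map (LinearMap.snd ℂ B₁ B₂) (LinearMap.fst ℂ C₁ C₂)) T

/-- The block `T_{112}`. -/
noncomputable def block112 (T : (A₁ × A₂) ⊗[ℂ] ((B₁ × B₂) ⊗[ℂ] (C₁ × C₂))) :
    A₁ ⊗[ℂ] (B₁ ⊗[ℂ] C₂) :=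
  TensorProduct.map (LinearMap.fst ℂ A₁ A₂)
    (TensorProduct.map (LinearMap.fst ℂ B₁ B₂) (LinearMap.snd ℂ C₁ C₂)) T

/-- The block `T_{222}`. -/
noncomputable def block222 (T : (A₁ × A₂) ⊗[ℂ] ((B₁ × B₂) ⊗[ℂ] (C₁ × C₂))) :
    A₂ ⊗[ℂ] (B₂ ⊗[ℂ] C₂) :=
  TensorProduct.map (LinearMap.snd ℂ A₁ A₂)
    (TensorProduct.map (LinearMap.snd ℂ B₁ B₂) (LinearMap.snd ℂ C₁ C₂)) T

/-- The block `T_{122}`. -/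
noncomputable def block122 (T : (A₁ × A₂) ⊗[ℂ] ((B₁ × B₂) ⊗[ℂ] (C₁ × C₂))) :
    A₁ ⊗[ℂ] (B₂ ⊗[ℂ] C₂) :=
  TensorProduct.map (LinearMap.fst ℂ A₁ A₂)
    (TensorProduct.map (LinearMap.snd ℂ B₁ B₂) (LinearMap.snd ℂ C₁ C₂)) T

/-- The block `T_{212}`. -/
noncomputable def block212 (T : (A₁ × A₂) ⊗[ℂ] ((B₁ × B₂) ⊗[ℂ] (C₁ × C₂))) :
    A₂ ⊗[ℂ] (B₁ ⊗[ℂ] C₂) :=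
  TensorProduct.map (LinearMap.snd ℂ A₁ A₂)
    (TensorProduct.map (LinearMap.fst ℂ B₁ B₂) (LinearMap.snd ℂ C₁ C₂)) T

/-- The block `T_{221}`. -/
noncomputable def block221 (T : (A₁ × A₂) ⊗[ℂ] ((B₁ × B₂) ⊗[ℂ] (C₁ × C₂))) :
    A₂ ⊗[ℂ] (B₂ ⊗[ℂ] C₁) :=
  TensorProduct.map (LinearMap.snd ℂ A₁ A₂)
    (TensorProduct.map (LinearMap.snd ℂ B₁ B₂) (LinearMap.fst ℂ C₁ C₂)) T

end Defs

theorem exists_tRank3_decomposition {A B C : Type*} [AddCommGroup A] [Module ℂ A]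
    [AddCommGroup B] [Module ℂ B] [AddCommGroup C] [Module ℂ C] (T : A ⊗[ℂ] (B ⊗[ℂ] C)) :
    ∃ (r : ℕ) (a : Fin r → A) (b : Fin r → B) (c : Fin r → C),
      T = ∑ i, a i ⊗ₜ[ℂ] (b i ⊗ₜ[ℂ] c i) := by
  have add : ∀ x y : A ⊗[ℂ] (B ⊗[ℂ] C),
      (∃ (r : ℕ) (a : Fin r → A) (b : Fin r → B) (c : Fin r → C),
        x = ∑ i, a i ⊗ₜ[ℂ] (b i ⊗ₜ[ℂ] c i)) →
      (∃ (r : ℕ) (a : Fin r → A) (b : Fin r → B) (c : Fin r → C),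
        y = ∑ i, a i ⊗ₜ[ℂ] (b i ⊗ₜ[ℂ] c i)) →
      ∃ (r : ℕ) (a : Fin r → A) (b : Fin r → B) (c : Fin r → C),
        x + y = ∑ i, a i ⊗ₜ[ℂ] (b i ⊗ₜ[ℂ] c i) := by
    rintro x y ⟨r, a, b, c, rfl⟩ ⟨s, a', b', c', rfl⟩
    exact ⟨r + s, Fin.append a a', Fin.append b b', Fin.append c c', by simp [Fin.sum_univ_add]⟩
  induction T with
  | zero => exact ⟨0, Fin.elim0, Fin.elim0, Fin.elim0, by simp⟩
  | add x y hx hy => exact add x y hx hy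
  | tmul a m =>
    induction m with
    | zero => exact ⟨0, Fin.elim0, Fin.elim0, Fin.elim0, by simp⟩
    | add x y hx hy => rw [TensorProduct.tmul_add]; exact add _ _ hx hy
    | tmul b c => exact ⟨1, fun _ => a, fun _ => b, fun _ => c, by simp⟩

theorem exists_eq_sum_of_tRank3_le {A B C : Type*} [AddCommGroup A] [Module ℂ A]
    [AddCommGroup B] [Module ℂ B] [AddCommGroup C] [Module ℂ C] {T : A ⊗[ℂ] (B ⊗[ℂ] C)} {s : ℕ}
    (h : tRank3 T ≤ s) : ∃ (a : Fin s → A) (b : Fin s → B) (c : Fin s → C),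
      T = ∑ i, a i ⊗ₜ[ℂ] (b i ⊗ₜ[ℂ] c i) := by
  obtain ⟨r, hr, a, b, c, rfl⟩ : ∃ r ≤ s, ∃ (a : Fin r → A) (b : Fin r → B) (c : Fin r → C),
      T = ∑ i, a i ⊗ₜ[ℂ] (b i ⊗ₜ[ℂ] c i) :=
    ⟨_, h, Nat.sInf_mem (s := {r : ℕ | ∃ (a : Fin r → A) (b : Fin r → B) (c : Fin r → C),
      T = ∑ i, a i ⊗ₜ[ℂ] (b i ⊗ₜ[ℂ] c i)}) (exists_tRank3_decomposition T)⟩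
  obtain ⟨d, rfl⟩ := Nat.exists_eq_add_of_le hr
  exact ⟨Fin.append a 0, Fin.append b 0, Fin.append c 0, by simp [Fin.sum_univ_add]⟩

theorem tRank3_sum_le_card {A B C ι : Type*} [AddCommGroup A] [Module ℂ A]
    [AddCommGroup B] [Module ℂ B] [AddCommGroup C] [Module ℂ C] [Fintype ι]
    (a : ι → A) (b : ι → B) (c : ι → C) :
    tRank3 (∑ i, a i ⊗ₜ[ℂ] (b i ⊗ₜ[ℂ] c i)) ≤ Fintype.card ι := by
  refine Nat.sInf_le ⟨a ∘ (Fintype.equivFin ι).symm, b ∘ (Fintype.equivFin ι).symm,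
    c ∘ (Fintype.equivFin ι).symm, ?_⟩
  exact ((Fintype.equivFin ι).symm.sum_comp fun i => a i ⊗ₜ[ℂ] (b i ⊗ₜ[ℂ] c i)).symm

/-- The `(i, j)` entry of a tensor in `ℂᵖ ⊗ ℂ^q`. -/
noncomputable def tensorEntry {p q : ℕ} (i : Fin p) (j : Fin q) :
    (Fin p → ℂ) ⊗[ℂ] (Fin q → ℂ) →ₗ[ℂ] ℂ :=
  (TensorProduct.lid ℂ ℂ).toLinearMap ∘ₗ
    TensorProduct.map (LinearMap.proj i) (LinearMap.proj j)

/-- The `(i, j, k)` entry of a tensor in `ℂᵖ ⊗ ℂ^q ⊗ ℂʳ`. -/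
noncomputable def tensorEntry₃ {p q r : ℕ} (i : Fin p) (j : Fin q) (k : Fin r) :
    (Fin p → ℂ) ⊗[ℂ] ((Fin q → ℂ) ⊗[ℂ] (Fin r → ℂ)) →ₗ[ℂ] ℂ :=
  (TensorProduct.lid ℂ ℂ).toLinearMap ∘ₗ
    TensorProduct.map (LinearMap.proj i) (tensorEntry j k)

@[simp]
theorem tensorEntry_tmul {p q : ℕ} (i : Fin p) (j : Fin q) (a : Fin p → ℂ) (b : Fin q → ℂ) :
    tensorEntry i j (a ⊗ₜ[ℂ] b) = a i * b j := by
  simp [tensorEntry]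

@[simp]
theorem tensorEntry₃_tmul {p q r : ℕ} (i : Fin p) (j : Fin q) (k : Fin r) (a : Fin p → ℂ)
    (m : (Fin q → ℂ) ⊗[ℂ] (Fin r → ℂ)) :
    tensorEntry₃ i j k (a ⊗ₜ[ℂ] m) = a i * tensorEntry j k m := by
  simp [tensorEntry₃]

theorem tensorEntry₃_assoc_tmul {p q r : ℕ} (i : Fin p) (j : Fin q) (k : Fin r)
    (w : (Fin p → ℂ) ⊗[ℂ] (Fin q → ℂ)) (c : Fin r → ℂ) :
    tensorEntry₃ i j k (TensorProduct.assoc ℂ _ _ _ (w ⊗ₜ[ℂ] c)) = tensorEntry i j w * c k := by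
  induction w with
  | zero => rw [TensorProduct.zero_tmul, LinearEquiv.map_zero, map_zero, map_zero, zero_mul]
  | add x y hx hy => simp [TensorProduct.add_tmul, hx, hy, add_mul]
  | tmul a b => simp [mul_assoc]

theorem tensorEntry_contract {p q r : ℕ} (i : Fin p) (j : Fin q)
    (Y : (Fin p → ℂ) ⊗[ℂ] ((Fin q → ℂ) ⊗[ℂ] (Fin r → ℂ))) (f : Module.Dual ℂ (Fin r → ℂ)) :
    tensorEntry i j (TensorProduct.map LinearMap.id (TensorProduct.rid ℂ (Fin q → ℂ)).toLinearMap
      (TensorProduct.map LinearMap.id (TensorProduct.map LinearMap.id f) Y)) =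
      ∑ k, f (Pi.single k 1) * tensorEntry₃ i j k Y := by
  induction Y with
  | zero => simp
  | add x y hx hy => simp only [map_add, hx, hy, mul_add, Finset.sum_add_distrib]
  | tmul a m =>
    induction m with
    | zero => simp
    | add x y hx hy =>
      simp only [TensorProduct.tmul_add, map_add, hx, hy, mul_add, Finset.sum_add_distrib]
    | tmul b c =>
      have hf : f c = ∑ k, c k * f (Pi.single k 1) := by
        rw [LinearMap.pi_apply_eq_sum_univ f c]
        refine Finset.sum_congr rfl fun k _ => ?_
        rw [smul_eq_mul]
        congr 2
        ext l
        simp [Pi.single_apply, eq_comm]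
      simp only [TensorProduct.map_tmul, LinearMap.id_apply, LinearEquiv.coe_coe,
        TensorProduct.rid_tmul, tensorEntry_tmul, tensorEntry₃_tmul, Pi.smul_apply, smul_eq_mul,
        hf, Finset.sum_mul, Finset.mul_sum]
      exact Finset.sum_congr rfl fun k _ => by ring

theorem exists_tensorEntry_of_mem_flatImageC {p q r : ℕ}
    {Y : (Fin p → ℂ) ⊗[ℂ] ((Fin q → ℂ) ⊗[ℂ] (Fin r → ℂ))}
    {w : (Fin p → ℂ) ⊗[ℂ] (Fin q → ℂ)} (hw : w ∈ flatImageC Y) :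
    ∃ g : Fin r → ℂ, ∀ i j, tensorEntry i j w = ∑ k, g k * tensorEntry₃ i j k Y := by
  induction hw using Submodule.span_induction with
  | mem x hx =>
    obtain ⟨f, rfl⟩ := hx
    exact ⟨fun k => f (Pi.single k 1), fun i j => tensorEntry_contract i j Y f⟩
  | zero => exact ⟨0, by simp⟩
  | add x y _ _ hx hy =>
    obtain ⟨g, hg⟩ := hx
    obtain ⟨h, hh⟩ := hy
    exact ⟨g + h, fun i j => by simp [hg, hh, add_mul, Finset.sum_add_distrib]⟩
  | smul t x _ hx =>
    obtain ⟨g, hg⟩ := hx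
    exact ⟨t • g, fun i j => by simp [hg, Finset.mul_sum, mul_assoc]⟩

theorem exists_tensorEntry₃_of_mem_span {p q r s : ℕ}
    {Y : (Fin p → ℂ) ⊗[ℂ] ((Fin q → ℂ) ⊗[ℂ] (Fin r → ℂ))}
    {X : (Fin p → ℂ) ⊗[ℂ] ((Fin q → ℂ) ⊗[ℂ] (Fin s → ℂ))}
    (hX : X ∈ Submodule.span ℂ {x | ∃ c : Fin s → ℂ, ∃ w ∈ flatImageC Y,
      x = (TensorProduct.assoc ℂ (Fin p → ℂ) (Fin q → ℂ) (Fin s → ℂ)) (w ⊗ₜ[ℂ] c)}) :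
    ∃ g : Fin s → Fin r → ℂ, ∀ i j k,
      tensorEntry₃ i j k X = ∑ l, g k l * tensorEntry₃ i j l Y := by
  induction hX using Submodule.span_induction with
  | mem x hx =>
    obtain ⟨c, w, hw, rfl⟩ := hx
    obtain ⟨g, hg⟩ := exists_tensorEntry_of_mem_flatImageC hw
    refine ⟨fun k l => c k * g l, fun i j k => ?_⟩
    rw [tensorEntry₃_assoc_tmul, hg, Finset.sum_mul]
    exact Finset.sum_congr rfl fun l _ => by ring
  | zero => exact ⟨0, by simp⟩
  | add x y _ _ hx hy =>
    obtain ⟨g, hg⟩ := hx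
    obtain ⟨h, hh⟩ := hy
    exact ⟨g + h, fun i j k => by simp [hg, hh, add_mul, Finset.sum_add_distrib]⟩
  | smul t x _ hx =>
    obtain ⟨g, hg⟩ := hx
    exact ⟨t • g, fun i j k => by simp [hg, Finset.mul_sum, mul_assoc]⟩

theorem AlgebraicIndependent.card_le_of_mem_adjoin {ι κ K L : Type} [Fintype ι] [Fintype κ]
    [Field K] [Field L] [Algebra K L] {x : ι → L} (hx : AlgebraicIndependent K x) {y : κ → L}
    (h : ∀ i, x i ∈ Algebra.adjoin K (Set.range y)) : Fintype.card ι ≤ Fintype.card κ := by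
  have hy : Algebra.adjoin K (Set.range y) = (MvPolynomial.aeval (R := K) y).range :=
    Algebra.adjoin_range_eq_range_aeval K y
  rw [hy] at h
  have hx' : AlgebraicIndependent K
      (fun i => (⟨x i, h i⟩ : (MvPolynomial.aeval (R := K) y).range)) :=
    (AlgHom.algebraicIndependent_iff (MvPolynomial.aeval (R := K) y).range.val
      Subtype.val_injective).1 hx
  have h₁ := hx'.cardinalMk_le_trdeg
  have h₂ := trdeg_le_of_surjective (MvPolynomial.aeval (R := K) y).rangeRestrict
    (MvPolynomial.aeval (R := K) y).rangeRestrict_surjective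
  rw [MvPolynomial.trdeg_of_isDomain] at h₂
  simpa using h₁.trans h₂

theorem Complex.exists_algebraicIndependent_rat (ι : Type) [Finite ι] :
    ∃ x : ι → ℂ, AlgebraicIndependent ℚ x := by
  obtain ⟨s, hs⟩ := exists_isTranscendenceBasis ℚ ℂ
  have hc : Cardinal.mk ℂ = Cardinal.mk s :=
    IsAlgClosed.cardinal_eq_cardinal_transcendence_basis_of_aleph0_lt' _ hs (by simp)
      (by rw [Cardinal.mk_complex]; exact Cardinal.aleph0_lt_continuum)
  have hle : Cardinal.mk ι ≤ Cardinal.mk s := by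
    rw [← hc, Cardinal.mk_complex]
    exact (Cardinal.lt_aleph0_of_finite ι).le.trans Cardinal.aleph0_lt_continuum.le
  obtain ⟨e⟩ := hle
  exact ⟨_, hs.1.comp e e.injective⟩

theorem eq_zero_of_mem_span_flatImageA_zero {A A' B C : Type*} [AddCommGroup A] [Module ℂ A]
    [AddCommGroup A'] [Module ℂ A'] [AddCommGroup B] [Module ℂ B] [AddCommGroup C] [Module ℂ C]
    {X : A ⊗[ℂ] (B ⊗[ℂ] C)} (hX : X ∈ Submodule.span ℂ
      {x | ∃ a : A, ∃ w ∈ flatImageA (0 : A' ⊗[ℂ] (B ⊗[ℂ] C)), x = a ⊗ₜ[ℂ] w}) : X = 0 := by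
  rw [← Submodule.mem_bot ℂ]
  refine Submodule.span_le.2 ?_ hX
  rintro _ ⟨a, w, hw, rfl⟩
  have : w = 0 := by
    rw [← Submodule.mem_bot ℂ]
    refine Submodule.span_le.2 ?_ hw
    rintro _ ⟨f, rfl⟩
    simp
  simp [this]

theorem eq_zero_of_mem_span_flatImageB_zero {A B B' C : Type*} [AddCommGroup A] [Module ℂ A]
    [AddCommGroup B] [Module ℂ B] [AddCommGroup B'] [Module ℂ B'] [AddCommGroup C] [Module ℂ C]
    {X : A ⊗[ℂ] (B ⊗[ℂ] C)} (hX : X ∈ Submodule.span ℂ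
      {x | ∃ b : B, ∃ w ∈ flatImageB (0 : A ⊗[ℂ] (B' ⊗[ℂ] C)),
        x = TensorProduct.map LinearMap.id (TensorProduct.comm ℂ C B).toLinearMap
          ((TensorProduct.assoc ℂ A C B) (w ⊗ₜ[ℂ] b))}) : X = 0 := by
  rw [← Submodule.mem_bot ℂ]
  refine Submodule.span_le.2 ?_ hX
  rintro _ ⟨b, w, hw, rfl⟩
  have : w = 0 := by
    rw [← Submodule.mem_bot ℂ]
    refine Submodule.span_le.2 ?_ hw
    rintro _ ⟨f, rfl⟩
    simp
  simp [this]

/-- Tensors whose entries are jointly algebraically independent have large modification rank,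
by counting parameters. -/
theorem lt_minModRank_of_algebraicIndependent {p q r s t p' q' : ℕ}
    (X : (Fin p → ℂ) ⊗[ℂ] ((Fin q → ℂ) ⊗[ℂ] (Fin s → ℂ)))
    (Y : (Fin p → ℂ) ⊗[ℂ] ((Fin q → ℂ) ⊗[ℂ] (Fin r → ℂ)))
    (h : AlgebraicIndependent ℚ (Sum.elim
      (fun i : Fin p × Fin q × Fin s => tensorEntry₃ i.1 i.2.1 i.2.2 X)
      (fun i : Fin p × Fin q × Fin r => tensorEntry₃ i.1 i.2.1 i.2.2 Y)))
    (hlt : t * (p + q + s) + s * r < p * q * s) :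
    t < minModRank X (flatImageA (0 : (Fin p' → ℂ) ⊗[ℂ] _))
      (flatImageB (0 : _ ⊗[ℂ] ((Fin q' → ℂ) ⊗[ℂ] _))) (flatImageC Y) := by
  have hne : (modSet X (flatImageA (0 : (Fin p' → ℂ) ⊗[ℂ] _))
      (flatImageB (0 : _ ⊗[ℂ] ((Fin q' → ℂ) ⊗[ℂ] _))) (flatImageC Y)).Nonempty :=
    ⟨X, 0, zero_mem _, 0, zero_mem _, 0, zero_mem _, by simp⟩
  obtain ⟨T, ⟨XA, hXA, XB, hXB, XC, hXC, rfl⟩, hT⟩ := Nat.sInf_mem (hne.image tRank3)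
  rw [minModRank, ← hT]
  by_contra! hle
  obtain ⟨a, b, c, habc⟩ := exists_eq_sum_of_tRank3_le hle
  obtain ⟨g, hg⟩ := exists_tensorEntry₃_of_mem_span hXC
  rw [eq_zero_of_mem_span_flatImageA_zero hXA, eq_zero_of_mem_span_flatImageB_zero hXB, add_zero,
    add_zero] at habc
  let y : (Fin t × (Fin p ⊕ Fin q ⊕ Fin s)) ⊕ (Fin s × Fin r) ⊕ (Fin p × Fin q × Fin r) → ℂ :=
    Sum.elim (fun m => Sum.elim (a m.1) (Sum.elim (b m.1) (c m.1)) m.2)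
      (Sum.elim (fun m => g m.1 m.2) (fun m => tensorEntry₃ m.1 m.2.1 m.2.2 Y))
  have hy : ∀ m, y m ∈ Algebra.adjoin ℚ (Set.range y) := fun m =>
    Algebra.subset_adjoin ⟨m, rfl⟩
  have key := h.card_le_of_mem_adjoin (y := y) (by
    rintro (⟨i, j, k⟩ | m)
    · have he : tensorEntry₃ i j k X = ∑ m, a m i * (b m j * c m k) -
          ∑ l, g k l * tensorEntry₃ i j l Y := by
        rw [← hg, eq_sub_iff_add_eq, ← map_add, habc]
        simp
      simp only [Sum.elim_inl, he]
      refine sub_mem (sum_mem fun m _ => ?_) (sum_mem fun l _ => ?_)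
      · exact mul_mem (hy (.inl (m, .inl i)))
          (mul_mem (hy (.inl (m, .inr (.inl j)))) (hy (.inl (m, .inr (.inr k)))))
      · exact mul_mem (hy (.inr (.inl (k, l)))) (hy (.inr (.inr (i, j, l))))
    · exact hy (.inr (.inr m)))
  simp only [Fintype.card_sum, Fintype.card_prod, Fintype.card_fin, ← mul_assoc,
    ← add_assoc] at key
  omega

/-- The tensor with entries `u i j k`. -/
noncomputable def tensorOfEntries {p q r : ℕ} (u : Fin p → Fin q → Fin r → ℂ) :
    (Fin p → ℂ) ⊗[ℂ] ((Fin q → ℂ) ⊗[ℂ] (Fin r → ℂ)) :=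
  ∑ i, ∑ j, Pi.single i 1 ⊗ₜ[ℂ] (Pi.single j 1 ⊗ₜ[ℂ] u i j)

@[simp]
theorem tensorEntry₃_tensorOfEntries {p q r : ℕ} (u : Fin p → Fin q → Fin r → ℂ)
    (i : Fin p) (j : Fin q) (k : Fin r) : tensorEntry₃ i j k (tensorOfEntries u) = u i j k := by
  simp [tensorOfEntries, Pi.single_apply]

/-- The tensor whose slices are the block diagonal matrices `diag(M, Mᵀ)`, for `M` running through
the slices of `u` and `v`. -/
noncomputable def transposePairTensor {n r : ℕ} (u v : Fin n → Fin n → Fin r → ℂ) :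
    ((Fin n → ℂ) × (Fin n → ℂ)) ⊗[ℂ]
      (((Fin n → ℂ) × (Fin n → ℂ)) ⊗[ℂ] ((Fin r → ℂ) × (Fin r → ℂ))) :=
  ∑ i, ∑ j, ((Pi.single i 1, 0) ⊗ₜ[ℂ] ((Pi.single j 1, 0) ⊗ₜ[ℂ] (u i j, v i j)) +
    (0, Pi.single j 1) ⊗ₜ[ℂ] ((0, Pi.single i 1) ⊗ₜ[ℂ] (u i j, v i j)))

/-- `E_ij ⊕ E_ji` is a rank one matrix minus a matrix depending only on `i` minus a matrix
depending only on `j`. -/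
theorem tRank3_transposePairTensor_le {n r : ℕ} (u v : Fin n → Fin n → Fin r → ℂ) :
    tRank3 (transposePairTensor u v) ≤ n * n + (n + n) := by
  let w : Fin n → Fin n → (Fin r → ℂ) × (Fin r → ℂ) := fun i j => (u i j, v i j)
  let e : Fin n → (Fin n → ℂ) × (Fin n → ℂ) := fun i => (Pi.single i 1, 0)
  let f : Fin n → (Fin n → ℂ) × (Fin n → ℂ) := fun i => (0, Pi.single i 1)
  have h : transposePairTensor u v = ∑ m : (Fin n × Fin n) ⊕ Fin n ⊕ Fin n,
      (Sum.elim (fun m => e m.1 + f m.2) (Sum.elim e f) m) ⊗ₜ[ℂ]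
        ((Sum.elim (fun m => e m.2 + f m.1) (Sum.elim f e) m) ⊗ₜ[ℂ]
        (Sum.elim (fun m => w m.1 m.2)
          (Sum.elim (fun i => -∑ j, w i j) (fun j => -∑ i, w i j)) m)) := by
    have hcomm : ∑ j, f j ⊗ₜ[ℂ] (e j ⊗ₜ[ℂ] ∑ i, w i j) =
        ∑ i, ∑ j, f j ⊗ₜ[ℂ] (e j ⊗ₜ[ℂ] w i j) := by
      rw [Finset.sum_comm]
      simp only [TensorProduct.tmul_sum]
    simp only [Fintype.sum_sum_type, Fintype.sum_prod_type, Sum.elim_inl, Sum.elim_inr, TensorProduct.tmul_neg,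
      Finset.sum_neg_distrib, hcomm]
    simp only [TensorProduct.tmul_sum, ← Finset.sum_neg_distrib, ← Finset.sum_add_distrib]
    refine Finset.sum_congr rfl fun i _ => Finset.sum_congr rfl fun j _ => ?_
    simp only [TensorProduct.add_tmul, TensorProduct.tmul_add, e, f, w]
    abel
  rw [h]
  refine (tRank3_sum_le_card _ _ _).trans (le_of_eq ?_)
  simp

/-- **Shitov's Claim 6.** There exist finite-dimensional complex vector spaces
`A₁, A₂, B₁, B₂, C₁, C₂` and a tensor `T ∈ (A₁⊕A₂)⊗(B₁⊕B₂)⊗(C₁⊕C₂)` whose rank is strictly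
smaller than the sum of the two minimal modification ranks of its corner blocks. -/
theorem exists_tensor_small_rank_blocks :
    ∃ (a₁ a₂ b₁ b₂ c₁ c₂ : ℕ)
      (T : ((Fin a₁ → ℂ) × (Fin a₂ → ℂ)) ⊗[ℂ]
        (((Fin b₁ → ℂ) × (Fin b₂ → ℂ)) ⊗[ℂ] ((Fin c₁ → ℂ) × (Fin c₂ → ℂ)))),
      tRank3 T <
        minModRank (block111 T) (flatImageA (block211 T)) (flatImageB (block121 T))
          (flatImageC (block112 T)) +
        minModRank (block222 T) (flatImageA (block122 T)) (flatImageB (block212 T))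
          (flatImageC (block221 T)) := by
  obtain ⟨x, hx⟩ := Complex.exists_algebraicIndependent_rat
    ((Fin 30 × Fin 30 × Fin 200) ⊕ (Fin 30 × Fin 30 × Fin 200))
  let u : Fin 30 → Fin 30 → Fin 200 → ℂ := fun i j k => x (.inl (i, j, k))
  let v : Fin 30 → Fin 30 → Fin 200 → ℂ := fun i j k => x (.inr (i, j, k))
  refine ⟨30, 30, 30, 30, 200, 200, transposePairTensor u v, ?_⟩
  have h111 : block111 (transposePairTensor u v) = tensorOfEntries u := by
    simp [block111, transposePairTensor, tensorOfEntries]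
  have h112 : block112 (transposePairTensor u v) = tensorOfEntries v := by
    simp [block112, transposePairTensor, tensorOfEntries]
  have h222 : block222 (transposePairTensor u v) = tensorOfEntries fun i j => v j i := by
    rw [tensorOfEntries, Finset.sum_comm]
    simp [block222, transposePairTensor]
  have h221 : block221 (transposePairTensor u v) = tensorOfEntries fun i j => u j i := by
    rw [tensorOfEntries, Finset.sum_comm]
    simp [block221, transposePairTensor]
  have h211 : block211 (transposePairTensor u v) = 0 := by
    simp [block211, transposePairTensor]
  have h121 : block121 (transposePairTensor u v) = 0 := by
    simp [block121, transposePairTensor]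
  have h122 : block122 (transposePairTensor u v) = 0 := by
    simp [block122, transposePairTensor]
  have h212 : block212 (transposePairTensor u v) = 0 := by
    simp [block212, transposePairTensor]
  rw [h111, h112, h222, h221, h211, h121, h122, h212]
  have hrank := tRank3_transposePairTensor_le u v
  have h₁ := lt_minModRank_of_algebraicIndependent (t := 480) (p' := 30) (q' := 30)
    (tensorOfEntries u) (tensorOfEntries v) (by
      convert hx using 1
      ext (i | i) <;> simp [u, v]) (by norm_num)
  let σ : (Fin 30 × Fin 30 × Fin 200) ⊕ (Fin 30 × Fin 30 × Fin 200) →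
      (Fin 30 × Fin 30 × Fin 200) ⊕ (Fin 30 × Fin 30 × Fin 200) :=
    Sum.elim (fun i => .inr (i.2.1, i.1, i.2.2)) (fun i => .inl (i.2.1, i.1, i.2.2))
  have hσ : Function.Involutive σ := by rintro (_ | _) <;> rfl
  have h₂ := lt_minModRank_of_algebraicIndependent (t := 480) (p' := 30) (q' := 30)
    (tensorOfEntries fun i j => v j i) (tensorOfEntries fun i j => u j i) (by
      convert hx.comp σ hσ.injective using 1
      ext (i | i) <;> simp [u, v, σ]) (by norm_num)
  omega
end

section
/- In the Φ-tensor construction, the Σ_θ-clone w^{Σ_θ} ∈ (A⊗(ℂ^σ)^{⊗θ})⊗(B⊗(ℂ^σ)^{⊗θ}) of w belongs to the subspace M = span(F ∪ U). -/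
open TensorProduct

/-- `(ℂ^σ)^{⊗θ}`, realized as the space of functions on multi-indices
`(α₁,…,α_θ) ∈ (Fin σ)^θ`. -/
abbrev Wsp (θ σ : ℕ) : Type := (Fin θ → Fin σ) → ℂ

/-- The canonical basis vector `e_{α₁} ⊗ ⋯ ⊗ e_{α_θ}` of `(ℂ^σ)^{⊗θ}`. -/
noncomputable def bvec {θ σ : ℕ} (φ : Fin θ → Fin σ) : Wsp θ σ := Pi.single φ 1

/-- Selection of one of the two components of a pair in `Fin σ × Fin σ` (the pair encodes an
element `s ∈ {0,…,σ²−1}` via `s = (u(s,1)−1)σ + (u(s,2)−1)`; `sel p true = u(s,1)`,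
`sel p false = u(s,2)`). -/
def sel {σ : ℕ} (p : Fin σ × Fin σ) (b : Bool) : Fin σ := if b then p.1 else p.2

section Phi

variable {A B : Type*} [AddCommGroup A] [Module ℂ A] [AddCommGroup B] [Module ℂ B]

/-- The Φ-tensor `M^Φ` associated to families `a`, `b` and the functions `π_i`
(here `π i : Fin θ → Bool`, with `true`/`false` standing for the values `1`/`2`, and
`!(π j)` standing for `3 − π_j`). -/
noncomputable def PhiTensor {r θ σ : ℕ} (a : Fin r → A) (b : Fin r → B)
    (π : Fin r → Fin θ → Bool) (Φ : Fin θ → Fin σ × Fin σ) :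
    (A ⊗[ℂ] Wsp θ σ) ⊗[ℂ] (B ⊗[ℂ] Wsp θ σ) :=
  (∑ i, a i ⊗ₜ[ℂ] bvec (fun γ => sel (Φ γ) (π i γ))) ⊗ₜ[ℂ]
    (∑ j, b j ⊗ₜ[ℂ] bvec (fun δ => sel (Φ δ) (!(π j δ))))

/-- The `(i,j)`-block `M(a_i^* ⊗ b_j^*) ∈ W ⊗ W` of `M ∈ (A⊗W)⊗(B⊗W)`. -/
noncomputable def blockOf {θ σ : ℕ} (f : Module.Dual ℂ A) (g : Module.Dual ℂ B)
    (M : (A ⊗[ℂ] Wsp θ σ) ⊗[ℂ] (B ⊗[ℂ] Wsp θ σ)) : Wsp θ σ ⊗[ℂ] Wsp θ σ :=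
  TensorProduct.map
    ((TensorProduct.lid ℂ (Wsp θ σ)).toLinearMap ∘ₗ TensorProduct.map f LinearMap.id)
    ((TensorProduct.lid ℂ (Wsp θ σ)).toLinearMap ∘ₗ TensorProduct.map g LinearMap.id) M

/-- Evaluation of an element of `W ⊗ W` against the pair of dual basis vectors `φ^* ⊗ ψ^*`. -/
noncomputable def evalPair {θ σ : ℕ} (φ ψ : Fin θ → Fin σ) :
    Wsp θ σ ⊗[ℂ] Wsp θ σ →ₗ[ℂ] ℂ :=
  TensorProduct.lift ((LinearMap.mul ℂ ℂ).compl₁₂ (LinearMap.proj φ) (LinearMap.proj ψ))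

/-- The set `𝓤` of unit matrices corresponding to entries that are nonzero in some
off-diagonal block of some Φ-tensor. -/
def Uset {r θ σ : ℕ} (a : Fin r → A) (b : Fin r → B) (π : Fin r → Fin θ → Bool)
    (astar : Fin r → Module.Dual ℂ A) (bstar : Fin r → Module.Dual ℂ B) :
    Set ((A ⊗[ℂ] Wsp θ σ) ⊗[ℂ] (B ⊗[ℂ] Wsp θ σ)) :=
  {x | ∃ i j : Fin r, i ≠ j ∧ ∃ φ ψ : Fin θ → Fin σ,
    (∃ Φ : Fin θ → Fin σ × Fin σ,
      evalPair φ ψ (blockOf (astar i) (bstar j) (PhiTensor a b π Φ)) ≠ 0) ∧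
    x = (a i ⊗ₜ[ℂ] bvec φ) ⊗ₜ[ℂ] (b j ⊗ₜ[ℂ] bvec ψ)}

/-- The space `𝓜 = span(𝓕 ∪ 𝓤)`, where `𝓕` is the set of all Φ-tensors. -/
noncomputable def Msp {r θ σ : ℕ} (a : Fin r → A) (b : Fin r → B)
    (π : Fin r → Fin θ → Bool)
    (astar : Fin r → Module.Dual ℂ A) (bstar : Fin r → Module.Dual ℂ B) :
    Submodule ℂ ((A ⊗[ℂ] Wsp θ σ) ⊗[ℂ] (B ⊗[ℂ] Wsp θ σ)) :=
  Submodule.span ℂ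
    (Set.range (PhiTensor a b π (σ := σ)) ∪ Uset a b π astar bstar)

end Phi

/-- For a fixed selector `p`, a map `Φ` into pairs amounts to the two multi-indices that `p` and
its complement select from it. -/
def selEquiv {θ σ : ℕ} (p : Fin θ → Bool) :
    (Fin θ → Fin σ × Fin σ) ≃ (Fin θ → Fin σ) × (Fin θ → Fin σ) where
  toFun Φ := (fun γ => sel (Φ γ) (p γ), fun γ => sel (Φ γ) (!(p γ)))
  invFun q γ := if p γ then (q.1 γ, q.2 γ) else (q.2 γ, q.1 γ)
  left_inv Φ := by
    funext γ
    cases h : p γ <;> simp [sel, h]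
  right_inv q := by
    ext γ <;> cases h : p γ <;> simp [sel, h]

section Phi

variable {A B : Type*} [AddCommGroup A] [Module ℂ A] [AddCommGroup B] [Module ℂ B]

theorem evalPair_blockOf_PhiTensor_self {r θ σ : ℕ} (a : Fin r → A) (b : Fin r → B)
    (π : Fin r → Fin θ → Bool)
    (astar : Fin r → Module.Dual ℂ A) (bstar : Fin r → Module.Dual ℂ B)
    (hastar : ∀ i k, astar i (a k) = if i = k then 1 else 0)
    (hbstar : ∀ j k, bstar j (b k) = if j = k then 1 else 0)
    (Φ : Fin θ → Fin σ × Fin σ) (i j : Fin r) :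
    evalPair (fun γ => sel (Φ γ) (π i γ)) (fun γ => sel (Φ γ) (!(π j γ)))
      (blockOf (astar i) (bstar j) (PhiTensor a b π Φ)) = 1 := by
  simp [PhiTensor, blockOf, evalPair, bvec, hastar, hbstar, ite_smul]

theorem PhiTensor_mem_Msp {r θ σ : ℕ} (a : Fin r → A) (b : Fin r → B)
    (π : Fin r → Fin θ → Bool)
    (astar : Fin r → Module.Dual ℂ A) (bstar : Fin r → Module.Dual ℂ B)
    (Φ : Fin θ → Fin σ × Fin σ) : PhiTensor a b π Φ ∈ Msp a b π astar bstar :=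
  Submodule.subset_span (Or.inl ⟨Φ, rfl⟩)

/-- The diagonal part of a `Φ`-tensor lies in `Msp`. -/
theorem sum_diag_mem_Msp {r θ σ : ℕ} (a : Fin r → A) (b : Fin r → B)
    (π : Fin r → Fin θ → Bool)
    (astar : Fin r → Module.Dual ℂ A) (bstar : Fin r → Module.Dual ℂ B)
    (hastar : ∀ i k, astar i (a k) = if i = k then 1 else 0)
    (hbstar : ∀ j k, bstar j (b k) = if j = k then 1 else 0)
    (Φ : Fin θ → Fin σ × Fin σ) :
    ∑ i, (a i ⊗ₜ[ℂ] bvec (fun γ => sel (Φ γ) (π i γ))) ⊗ₜ[ℂ]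
      (b i ⊗ₜ[ℂ] bvec (fun γ => sel (Φ γ) (!(π i γ)))) ∈ Msp a b π astar bstar := by
  have hsplit : PhiTensor a b π Φ =
      ∑ i, (a i ⊗ₜ[ℂ] bvec (fun γ => sel (Φ γ) (π i γ))) ⊗ₜ[ℂ]
          (b i ⊗ₜ[ℂ] bvec (fun γ => sel (Φ γ) (!(π i γ)))) +
        ∑ i, ∑ j ∈ Finset.univ.erase i, (a i ⊗ₜ[ℂ] bvec (fun γ => sel (Φ γ) (π i γ))) ⊗ₜ[ℂ]
          (b j ⊗ₜ[ℂ] bvec (fun γ => sel (Φ γ) (!(π j γ)))) := by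
    rw [PhiTensor, TensorProduct.sum_tmul, ← Finset.sum_add_distrib]
    refine Finset.sum_congr rfl fun i _ => ?_
    rw [TensorProduct.tmul_sum, ← Finset.add_sum_erase _ _ (Finset.mem_univ i)]
  rw [eq_sub_of_add_eq hsplit.symm]
  refine sub_mem (PhiTensor_mem_Msp a b π astar bstar Φ)
    (sum_mem fun i _ => sum_mem fun j hj => Submodule.subset_span (Or.inr ?_))
  refine ⟨i, j, (Finset.ne_of_mem_erase hj).symm, _, _, ⟨Φ, ?_⟩, rfl⟩
  rw [evalPair_blockOf_PhiTensor_self a b π astar bstar hastar hbstar Φ i j]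
  exact one_ne_zero

end Phi

/-- **The clone of `w` lies in `Msp`.** In the Phi-tensor construction, the `Σ_θ`-clone
`w^{Σ_θ} = Σ_i (a_i ⊗ S) ⊗ (b_i ⊗ S)` (where `S` is the sum of all canonical basis
vectors of `(ℂ^σ)^{⊗θ}`) belongs to the subspace `𝓜 = span(𝓕 ∪ 𝓤)`. -/
theorem clone_mem_Msp
    (A B C : Type*) [AddCommGroup A] [Module ℂ A] [FiniteDimensional ℂ A]
    [AddCommGroup B] [Module ℂ B] [FiniteDimensional ℂ B]
    [AddCommGroup C] [Module ℂ C] [FiniteDimensional ℂ C]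
    (r ρ θ σ : ℕ) (hr : 0 < r)
    (hρ : ρ = 2 * Module.finrank ℂ A * Module.finrank ℂ B * Module.finrank ℂ C + 1)
    (hθ : θ = Nat.clog 2 r) (hσ : σ = 2 * ρ ^ 2 * r)
    (a : Fin r → A) (b : Fin r → B)
    (ha : LinearIndependent ℂ a) (hb : LinearIndependent ℂ b)
    (w : A ⊗[ℂ] B) (hw : w = ∑ i, a i ⊗ₜ[ℂ] b i)
    (π : Fin r → Fin θ → Bool) (hπ : Function.Injective π)
    (astar : Fin r → Module.Dual ℂ A) (bstar : Fin r → Module.Dual ℂ B)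
    (hastar : ∀ i k, astar i (a k) = if i = k then 1 else 0)
    (hbstar : ∀ j k, bstar j (b k) = if j = k then 1 else 0) :
    (∑ i, (a i ⊗ₜ[ℂ] (∑ φ : Fin θ → Fin σ, bvec φ)) ⊗ₜ[ℂ]
        (b i ⊗ₜ[ℂ] (∑ ψ : Fin θ → Fin σ, bvec ψ)))
      ∈ Msp a b π astar bstar := by
  convert sum_mem (t := Finset.univ) fun Φ _ =>
    sum_diag_mem_Msp a b π astar bstar hastar hbstar Φ using 1
  rw [Finset.sum_comm]
  refine Finset.sum_congr rfl fun i _ => ?_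
  have h := (selEquiv (σ := σ) (π i)).sum_comp fun q =>
    (a i ⊗ₜ[ℂ] bvec q.1) ⊗ₜ[ℂ] (b i ⊗ₜ[ℂ] bvec q.2)
  refine Eq.trans ?_ h.symm
  simp only [TensorProduct.tmul_sum, TensorProduct.sum_tmul, Fintype.sum_prod_type]
  exact Finset.sum_comm
end

section
/- In the Φ-tensor construction, let M ∈ M and let i ≠ j with 1 ≤ i, j ≤ r. Then for every index τ ∈ {1,…,θ} with π_i(τ) ≠ π_j(τ) (at least one such τ exists since π_i ≠ π_j), the block M_{ij} = M(a_i^*⊗b_j^*) ∈ (ℂ^σ)^{⊗θ}⊗(ℂ^σ)^{⊗θ} lies in the span of the basis tensors e_{α_1}⊗⋯⊗e_{α_θ}⊗e_{β_1}⊗⋯⊗e_{β_θ} satisfying α_τ = β_τ; i.e., M_{ij} is block-diagonal with respect to the τ-th coordinates. -/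
open TensorProduct

section Phi

variable {A B : Type*} [AddCommGroup A] [Module ℂ A] [AddCommGroup B] [Module ℂ B]

theorem blockOf_tmul {θ σ : ℕ} (f : Module.Dual ℂ A) (g : Module.Dual ℂ B)
    (x : A) (φ : Wsp θ σ) (y : B) (ψ : Wsp θ σ) :
    blockOf f g ((x ⊗ₜ[ℂ] φ) ⊗ₜ[ℂ] (y ⊗ₜ[ℂ] ψ)) = (f x • φ) ⊗ₜ[ℂ] (g y • ψ) := by
  simp [blockOf]

theorem blockOf_PhiTensor {r θ σ : ℕ} {a : Fin r → A} {b : Fin r → B}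
    {astar : Fin r → Module.Dual ℂ A} {bstar : Fin r → Module.Dual ℂ B}
    (hastar : ∀ i k, astar i (a k) = if i = k then 1 else 0)
    (hbstar : ∀ j k, bstar j (b k) = if j = k then 1 else 0)
    (π : Fin r → Fin θ → Bool) (Φ : Fin θ → Fin σ × Fin σ) (i j : Fin r) :
    blockOf (astar i) (bstar j) (PhiTensor a b π Φ) =
      bvec (fun γ => sel (Φ γ) (π i γ)) ⊗ₜ[ℂ] bvec (fun δ => sel (Φ δ) (!(π j δ))) := by
  simp [blockOf, PhiTensor, hastar, hbstar]

theorem evalPair_bvec_tmul_bvec_ne_zero {θ σ : ℕ} {φ ψ α β : Fin θ → Fin σ}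
    (h : evalPair φ ψ (bvec α ⊗ₜ[ℂ] bvec β) ≠ 0) : φ = α ∧ ψ = β := by
  simpa [evalPair, bvec, Pi.single_apply, and_comm] using h

end Phi

/-- **Off-diagonal blocks are block-diagonal.** In the Φ-tensor construction, for every
`M ∈ 𝓜` and `i ≠ j`, and every `τ` with `π i τ ≠ π j τ`, the block `M_{ij} = M(aᵢ* ⊗ bⱼ*)`
lies in the span of the basis tensors `e_{α₁}⊗⋯⊗e_{α_θ} ⊗ e_{β₁}⊗⋯⊗e_{β_θ}` with
`α_τ = β_τ`. -/
theorem block_of_Msp_block_diagonal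
    (A B C : Type*) [AddCommGroup A] [Module ℂ A] [FiniteDimensional ℂ A]
    [AddCommGroup B] [Module ℂ B] [FiniteDimensional ℂ B]
    [AddCommGroup C] [Module ℂ C] [FiniteDimensional ℂ C]
    (r ρ θ σ : ℕ) (hr : 0 < r)
    (hρ : ρ = 2 * Module.finrank ℂ A * Module.finrank ℂ B * Module.finrank ℂ C + 1)
    (hθ : θ = Nat.clog 2 r) (hσ : σ = 2 * ρ ^ 2 * r)
    (a : Fin r → A) (b : Fin r → B)
    (ha : LinearIndependent ℂ a) (hb : LinearIndependent ℂ b)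
    (w : A ⊗[ℂ] B) (hw : w = ∑ i, a i ⊗ₜ[ℂ] b i)
    (π : Fin r → Fin θ → Bool) (hπ : Function.Injective π)
    (astar : Fin r → Module.Dual ℂ A) (bstar : Fin r → Module.Dual ℂ B)
    (hastar : ∀ i k, astar i (a k) = if i = k then 1 else 0)
    (hbstar : ∀ j k, bstar j (b k) = if j = k then 1 else 0)
    (M : (A ⊗[ℂ] Wsp θ σ) ⊗[ℂ] (B ⊗[ℂ] Wsp θ σ))
    (hM : M ∈ Msp a b π astar bstar)
    (i j : Fin r) (hij : i ≠ j) (τ : Fin θ) (hτ : π i τ ≠ π j τ) :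
    blockOf (astar i) (bstar j) M ∈
      Submodule.span ℂ {x : Wsp θ σ ⊗[ℂ] Wsp θ σ |
        ∃ α β : Fin θ → Fin σ, α τ = β τ ∧ x = bvec α ⊗ₜ[ℂ] bvec β} := by
  have hsel (Φ : Fin θ → Fin σ × Fin σ) : sel (Φ τ) (π i τ) = sel (Φ τ) (!(π j τ)) := by
    rw [Bool.eq_not_of_ne hτ]
  let S := Submodule.span ℂ {x : Wsp θ σ ⊗[ℂ] Wsp θ σ |
    ∃ α β : Fin θ → Fin σ, α τ = β τ ∧ x = bvec α ⊗ₜ[ℂ] bvec β}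
  suffices Msp a b π astar bstar ≤ S.comap (TensorProduct.map
      ((TensorProduct.lid ℂ (Wsp θ σ)).toLinearMap ∘ₗ
        TensorProduct.map (astar i) LinearMap.id)
      ((TensorProduct.lid ℂ (Wsp θ σ)).toLinearMap ∘ₗ
        TensorProduct.map (bstar j) LinearMap.id)) from this hM
  refine Submodule.span_le.2 ?_
  rintro _ (⟨Φ, rfl⟩ | ⟨k, l, -, φ, ψ, ⟨Φ, hΦ⟩, rfl⟩)
  · change blockOf (astar i) (bstar j) _ ∈ S
    rw [blockOf_PhiTensor hastar hbstar]
    exact Submodule.subset_span ⟨_, _, hsel Φ, rfl⟩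
  · change blockOf (astar i) (bstar j) _ ∈ S
    rw [blockOf_tmul, hastar, hbstar]
    by_cases hk : i = k
    · by_cases hl : j = l
      · subst hk hl
        rw [blockOf_PhiTensor hastar hbstar] at hΦ
        obtain ⟨rfl, rfl⟩ := evalPair_bvec_tmul_bvec_ne_zero hΦ
        rw [if_pos rfl, if_pos rfl, one_smul, one_smul]
        exact Submodule.subset_span ⟨_, _, hsel Φ, rfl⟩
      · simp [hl]
    · simp [hk]
end
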